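/- arXiv:1412.4876 — 3 statements merged into one kernel-verified Lean document; each statement's English description precedes it below -/
import Mathlib

section
/- Fix x_0, …, x_k ∈ ℝ^d with x_{k,d} ≠ x_{0,d} (last coordinates distinct). For λ ∈ ℝ^k set α(λ) = x_{0,d} + λ_1(x_{1,d} − x_{0,d}) + ⋯ + λ_k(x_{k,d} − x_{0,d}), and on the open set {λ : b·α(λ) + a ≠ 0} define T(λ) = (λ_1/(b α(λ) + a), …, λ_{k−1}/(b α(λ) + a), (a α(λ) + b)/(b α(λ) + a)). Then T is differentiable there and |det DT(λ)| = |x_{k,d} − x_{0,d}| / |b α(λ) + a|^{k+1}. -/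
open scoped BigOperators

theorem hasFDerivAt_quotient {E : Type*} [NormedAddCommGroup E] [NormedSpace ℝ E]
    {f g : E → ℝ} {f' g' : E →L[ℝ] ℝ} {x : E}
    (hf : HasFDerivAt f f' x) (hg : HasFDerivAt g g' x) (hx : g x ≠ 0) :
    HasFDerivAt (fun y => f y / g y) ((g x ^ 2)⁻¹ • (g x • f' - f x • g')) x := by
  have hinv : HasFDerivAt (fun y => (g y)⁻¹) (-(g x ^ 2)⁻¹ • g') x :=
    (hasDerivAt_inv hx).comp_hasFDerivAt x hg
  refine (hf.fun_mul hinv).congr_fderiv ?_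
  ext v
  simp only [add_apply, sub_apply, smul_apply, smul_eq_mul]
  field_simp
  ring

/-- The Jacobian matrix of the projective map
`l ↦ (l_0 / s, …, l_{n-1} / s, t / s)` whose denominator has gradient `b • c` and whose last
component has gradient `s⁻² • c`. -/
noncomputable def projectiveJacobian {n : ℕ} (c l : Fin (n + 1) → ℝ) (b s : ℝ) :
    Matrix (Fin (n + 1)) (Fin (n + 1)) ℝ :=
  fun j i => if j = Fin.last n then c i / s ^ 2
    else (if j = i then 1 / s else 0) - l j * b * (c i / s ^ 2)

theorem det_projectiveJacobian {n : ℕ} (c l : Fin (n + 1) → ℝ) (b s : ℝ) :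
    (projectiveJacobian c l b s).det = c (Fin.last n) / s ^ (n + 2) := by
  let N : Matrix (Fin (n + 1)) (Fin (n + 1)) ℝ := fun j i =>
    if j = Fin.last n then c i / s ^ 2 else if j = i then 1 / s else 0
  have hrow : (projectiveJacobian c l b s).det = N.det := by
    refine Matrix.det_eq_of_forall_row_eq_smul_add_const
      (fun j => if j = Fin.last n then 0 else -(l j * b)) (Fin.last n) (by simp) ?_
    intro j i
    by_cases hj : j = Fin.last n
    · simp [projectiveJacobian, N, hj]
    · simp only [projectiveJacobian, N, hj, if_false, if_true]
      ring
  have htri : N.det = ∏ i, N i i := by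
    refine Matrix.det_of_isLowerTriangular N ?_
    intro j i hji
    have hlt : j < i := hji
    have hj : j ≠ Fin.last n := (hlt.trans_le (Fin.le_last i)).ne
    simp [N, hj, hlt.ne]
  have hdiag (i : Fin n) : N i.castSucc i.castSucc = 1 / s := by
    simp [N, (Fin.castSucc_lt_last i).ne]
  have hcorner : N (Fin.last n) (Fin.last n) = c (Fin.last n) / s ^ 2 := by simp [N]
  rw [hrow, htri, Fin.prod_univ_castSucc, hcorner]
  simp only [hdiag, Finset.prod_const, Finset.card_univ, Fintype.card_fin]
  rw [one_div, inv_pow, pow_add, div_eq_mul_inv, div_eq_mul_inv, mul_inv]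
  ring

/-- fix `x_0, …, x_k ∈ ℝ^{d+1}` with distinct last coordinates of `x_0` and
`x_k`; set `α(λ) = x_{0,d} + λ_1 (x_{1,d} - x_{0,d}) + ⋯ + λ_k (x_{k,d} - x_{0,d})` and,
where `b α(λ) + a ≠ 0`,
`T(λ) = (λ_1/(b α + a), …, λ_{k-1}/(b α + a), (a α + b)/(b α + a))`.
Then `T` is differentiable there with `|det DT(λ)| = |x_{k,d} - x_{0,d}| / |b α(λ) + a|^{k+1}`. -/
theorem stmt11 (d k : ℕ) (hd : 1 ≤ d) (hk : 1 ≤ k) (hkd : k ≤ d)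
    (a b : ℝ) (hab : a ^ 2 - b ^ 2 = 1)
    (xs : Fin (k + 1) → EuclideanSpace ℝ (Fin (d + 1)))
    (hlast : xs (Fin.last k) (Fin.last d) ≠ xs 0 (Fin.last d))
    (alpha : EuclideanSpace ℝ (Fin k) → ℝ)
    (halpha : ∀ l, alpha l = xs 0 (Fin.last d) +
      ∑ i : Fin k, l i * (xs i.succ (Fin.last d) - xs 0 (Fin.last d)))
    (T : EuclideanSpace ℝ (Fin k) → EuclideanSpace ℝ (Fin k))
    (hT : ∀ l, ∀ j : Fin k, T l j =
      if (j : ℕ) = k - 1 then (a * alpha l + b) / (b * alpha l + a)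
      else l j / (b * alpha l + a))
    (lam : EuclideanSpace ℝ (Fin k)) (hlam : b * alpha lam + a ≠ 0) :
    ∃ D : EuclideanSpace ℝ (Fin k) →L[ℝ] EuclideanSpace ℝ (Fin k),
      HasFDerivAt T D lam ∧
      |LinearMap.det (D : EuclideanSpace ℝ (Fin k) →ₗ[ℝ] EuclideanSpace ℝ (Fin k))| =
        |xs (Fin.last k) (Fin.last d) - xs 0 (Fin.last d)| / |b * alpha lam + a| ^ (k + 1) := by
  obtain ⟨n, rfl⟩ : ∃ n, k = n + 1 := ⟨k - 1, by omega⟩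
  set c : Fin (n + 1) → ℝ := fun i => xs i.succ (Fin.last d) - xs 0 (Fin.last d) with hc
  set s := b * alpha lam + a with hs
  let A : EuclideanSpace ℝ (Fin (n + 1)) →L[ℝ] ℝ :=
    ∑ i, c i • EuclideanSpace.proj i
  have hA (v : EuclideanSpace ℝ (Fin (n + 1))) : A v = ∑ i, c i * v i := by
    simp [A]
  have hα : HasFDerivAt alpha A lam := by
    have hfun : alpha = fun l => xs 0 (Fin.last d) + A l := by
      funext l
      rw [halpha, hA]
      simp only [hc, mul_comm]
    rw [hfun]
    exact A.hasFDerivAt.const_add _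
  have hden : HasFDerivAt (fun l => b * alpha l + a) (b • A) lam :=
    (hα.const_mul b).add_const a
  have hnum : HasFDerivAt (fun l => a * alpha l + b) (a • A) lam :=
    (hα.const_mul a).add_const b
  let e := (EuclideanSpace.basisFun (Fin (n + 1)) ℝ).toBasis
  let M := projectiveJacobian c lam b s
  let D := LinearMap.toContinuousLinearMap (Matrix.toLin e e M)
  have hD (v : EuclideanSpace ℝ (Fin (n + 1))) (j : Fin (n + 1)) :
      D v j = ∑ i, M j i * v i := by
    simp [D, e, Matrix.toLin_apply, Matrix.mulVec, dotProduct, Pi.single_apply]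
  refine ⟨D, ?_, ?_⟩
  · rw [← hasFDerivWithinAt_univ, hasFDerivWithinAt_euclidean]
    intro j
    rw [hasFDerivWithinAt_univ]
    by_cases hj : j = Fin.last n
    · have hfun : (fun l => T l j) = fun l => (a * alpha l + b) / (b * alpha l + a) := by
        funext l
        rw [hT, if_pos (by simp [hj])]
      rw [hfun]
      refine (hasFDerivAt_quotient hnum hden hlam).congr_fderiv ?_
      ext v
      have hMv : D v j = A v / s ^ 2 := by
        rw [hD, hA, Finset.sum_div]
        refine Finset.sum_congr rfl fun i _ => ?_
        simp only [M, projectiveJacobian, if_pos hj]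
        ring
      have hgoal : (a * (b * alpha lam + a) - b * (a * alpha lam + b)) = 1 := by
        linear_combination hab
      change _ = D v j
      rw [hMv]
      simp only [sub_apply, smul_apply, smul_eq_mul, ← hs]
      field_simp
      linear_combination A v * hgoal
    · have hj' : (j : ℕ) ≠ n + 1 - 1 := fun h => hj (Fin.ext (by simpa using h))
      have hfun : (fun l => T l j) = fun l => l j / (b * alpha l + a) := by
        funext l
        rw [hT, if_neg hj']
      rw [hfun]
      have hproj : HasFDerivAt (fun l : EuclideanSpace ℝ (Fin (n + 1)) => l j)
          (EuclideanSpace.proj j : EuclideanSpace ℝ (Fin (n + 1)) →L[ℝ] ℝ) lam :=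
        (EuclideanSpace.proj j : EuclideanSpace ℝ (Fin (n + 1)) →L[ℝ] ℝ).hasFDerivAt
      refine (hasFDerivAt_quotient hproj hden hlam).congr_fderiv ?_
      ext v
      have hMv : D v j = v j / s - lam j * b * (A v / s ^ 2) := by
        rw [hD, hA, Finset.sum_div, Finset.mul_sum]
        simp only [M, projectiveJacobian, if_neg hj, sub_mul, Finset.sum_sub_distrib]
        congr 1
        · simp [div_eq_inv_mul]
        · refine Finset.sum_congr rfl fun i _ => ?_
          ring
      change _ = D v j
      rw [hMv]
      simp only [sub_apply, smul_apply, smul_eq_mul, ← hs, PiLp.proj_apply]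
      field_simp
  · have hdet : LinearMap.det (D : EuclideanSpace ℝ (Fin (n + 1)) →ₗ[ℝ] _) = M.det :=
      LinearMap.det_toLin e M
    rw [hdet, det_projectiveJacobian, abs_div, abs_pow]
    simp [hc]
end

section
/- Let t_0, t_1, …, t_k be reals with b t_i + a ≠ 0 for all i. Let M be the k×k real matrix whose i-th column, for 1 ≤ i ≤ k−1, is e_i/(b t_i + a) + ((a t_i + b)/(b t_i + a) − (a t_0 + b)/(b t_0 + a))·e_k, and whose k-th column is ((a t_k + b)/(b t_k + a) − (a t_0 + b)/(b t_0 + a))·e_k, where e_1,…,e_k is the standard basis of ℝ^k. Then |det M| = |t_k − t_0| / (|b t_0 + a|·|b t_1 + a|⋯|b t_k + a|). -/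
open scoped BigOperators

/-- The difference of two values of the fractional linear map `s ↦ (a s + b) / (b s + a)`
of determinant one. -/
theorem lorentz_boost_sub {a b s u : ℝ} (hab : a ^ 2 - b ^ 2 = 1)
    (hs : b * s + a ≠ 0) (hu : b * u + a ≠ 0) :
    (a * s + b) / (b * s + a) - (a * u + b) / (b * u + a) =
      (s - u) / ((b * s + a) * (b * u + a)) := by
  rw [div_sub_div _ _ hs hu]
  congr 1
  linear_combination (s - u) * hab

/-- let `t_0, …, t_k` be reals with `b t_i + a ≠ 0` for all `i`, and `M` the
`k × k` matrix whose `i`-th column (for `1 ≤ i ≤ k-1`) is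
`e_i/(b t_i + a) + ((a t_i + b)/(b t_i + a) - (a t_0 + b)/(b t_0 + a)) e_k` and whose `k`-th
column is `((a t_k + b)/(b t_k + a) - (a t_0 + b)/(b t_0 + a)) e_k`.  Then
`|det M| = |t_k - t_0| / (|b t_0 + a| ⋯ |b t_k + a|)`.
(Columns are 0-indexed: column `c : Fin k` is the paper's column `c + 1` and uses `t (c+1)`.) -/
theorem stmt12 (k : ℕ) (hk : 1 ≤ k) (a b : ℝ) (hab : a ^ 2 - b ^ 2 = 1)
    (t : Fin (k + 1) → ℝ) (ht : ∀ i, b * t i + a ≠ 0)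
    (M : Matrix (Fin k) (Fin k) ℝ)
    (hM : ∀ r c : Fin k, M r c =
      (if r = c ∧ (c : ℕ) ≠ k - 1 then 1 / (b * t c.succ + a) else 0) +
      (if (r : ℕ) = k - 1 then
        (a * t c.succ + b) / (b * t c.succ + a) - (a * t 0 + b) / (b * t 0 + a) else 0)) :
    |M.det| = |t (Fin.last k) - t 0| / ∏ i : Fin (k + 1), |b * t i + a| := by
  obtain ⟨n, rfl⟩ : ∃ n, k = n + 1 := ⟨k - 1, by omega⟩
  have htri : M.IsLowerTriangular := by
    intro r c hrc
    have hlt : (r : ℕ) < c := OrderDual.toDual_lt_toDual.mp hrc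
    have hne : r ≠ c := fun h => hlt.ne (congrArg Fin.val h)
    have hr : (r : ℕ) ≠ n + 1 - 1 := by omega
    rw [hM, if_neg (fun h => hne h.1), if_neg hr, add_zero]
  have hdiag (i : Fin n) : M i.castSucc i.castSucc = 1 / (b * t i.castSucc.succ + a) := by
    have hi : ((i.castSucc : Fin (n + 1)) : ℕ) ≠ n + 1 - 1 := by
      simp [i.isLt.ne]
    rw [hM, if_pos ⟨rfl, hi⟩, if_neg hi, add_zero]
  have hlast : M (Fin.last n) (Fin.last n) = (t (Fin.last (n + 1)) - t 0) /
      ((b * t (Fin.last (n + 1)) + a) * (b * t 0 + a)) := by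
    rw [hM, if_neg (by simp), if_pos (by simp), zero_add, Fin.succ_last,
      lorentz_boost_sub hab (ht _) (ht _)]
  rw [Matrix.det_of_isLowerTriangular M htri, Fin.prod_univ_castSucc, hlast,
    Fin.prod_univ_succ, Fin.prod_univ_castSucc, Fin.succ_last]
  simp only [hdiag, one_div, Finset.prod_inv_distrib, abs_mul, abs_inv, abs_div,
    Finset.abs_prod]
  rw [inv_mul_eq_div, div_div]
  congr 1
  ring
end

section
/- Every matrix L ∈ O(d,1) belongs to the subgroup of invertible (d+1)×(d+1) real matrices generated by the following elements: the matrix −Id_{d+1}; the matrices diag(Ω, 1) with Ω ∈ O(d) (the standard orthogonal group of ℝ^d, acting on the first d coordinates); and the pure boosts B_{a,b} with a² − b² = 1. -/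
open Matrix
/-- The Minkowski form matrix `η = diag(1, …, 1, -1)` on `ℝ^{d+1}`. -/
noncomputable def minkEta (d : ℕ) : Matrix (Fin (d + 1)) (Fin (d + 1)) ℝ :=
  Matrix.diagonal fun i => if i = Fin.last d then -1 else 1

/-- The pure boost `B_{a,b}` on `ℝ^{d+1}`: identity on the first `d - 1` coordinates,
acting on the last two coordinates by the matrix `((a, -b), (-b, a))`. -/
noncomputable def boostM (d : ℕ) (a b : ℝ) : Matrix (Fin (d + 1)) (Fin (d + 1)) ℝ :=
  fun i j =>
    if (i : ℕ) = d - 1 then (if (j : ℕ) = d - 1 then a else if (j : ℕ) = d then -b else 0)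
    else if (i : ℕ) = d then (if (j : ℕ) = d - 1 then -b else if (j : ℕ) = d then a else 0)
    else if (i : ℕ) = (j : ℕ) then 1 else 0

/-- The block matrix `diag(Ω, 1)` on `ℝ^{d+1}`, with `Ω` a `d × d` matrix acting on the
first `d` coordinates. -/
noncomputable def diagO (d : ℕ) (Ω : Matrix (Fin d) (Fin d) ℝ) :
    Matrix (Fin (d + 1)) (Fin (d + 1)) ℝ := fun i j =>
  if hi : i = Fin.last d then (if j = Fin.last d then 1 else 0)
  else if hj : j = Fin.last d then 0
  else Ω (i.castPred hi) (j.castPred hj)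

/-- Any two vectors of equal Euclidean length are related by an orthogonal matrix
(a Householder reflection). -/
lemma exists_orthogonal_mulVec_eq {n : Type*} [Fintype n] [DecidableEq n] (v w : n → ℝ)
    (h : v ⬝ᵥ v = w ⬝ᵥ w) : ∃ Ω : Matrix n n ℝ, Ωᵀ * Ω = 1 ∧ Ω *ᵥ v = w := by
  by_cases hvw : v = w
  · exact ⟨1, by simp, by simp [hvw]⟩
  set x := v - w with hx
  have hx0 : x ⬝ᵥ x ≠ 0 := by
    rw [Ne, dotProduct_self_eq_zero, hx, sub_eq_zero]
    exact hvw
  have hxv : x ⬝ᵥ x = 2 * (x ⬝ᵥ v) := by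
    simp only [hx, sub_dotProduct, dotProduct_sub, dotProduct_comm v w]
    linarith
  refine ⟨1 - (2 / (x ⬝ᵥ x)) • vecMulVec x x, ?_, ?_⟩
  · have hsq : vecMulVec x x * vecMulVec x x = (x ⬝ᵥ x) • vecMulVec x x := by
      ext i j
      simp [vecMulVec_mul_vecMulVec, vecMulVec_apply]
      ring
    rw [transpose_sub, transpose_smul, transpose_vecMulVec, transpose_one, sub_mul, mul_sub,
      mul_sub, smul_mul_smul_comm, hsq, smul_smul]
    have hc : 2 / (x ⬝ᵥ x) * (2 / (x ⬝ᵥ x)) * (x ⬝ᵥ x) = 2 / (x ⬝ᵥ x) + 2 / (x ⬝ᵥ x) := by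
      field_simp
      norm_num
    rw [hc, add_smul]
    simp
  · have hc : 2 / (x ⬝ᵥ x) * (x ⬝ᵥ v) = 1 := by
      field_simp
      linarith
    ext i
    rw [sub_mulVec, smul_mulVec, one_mulVec, vecMulVec_mulVec]
    simp only [Pi.sub_apply, Pi.smul_apply, smul_eq_mul, MulOpposite.smul_eq_mul_unop,
      MulOpposite.unop_op]
    have : 2 / (x ⬝ᵥ x) * (x i * (x ⬝ᵥ v)) = x i := by
      rw [mul_left_comm, hc, mul_one]
    rw [this, hx]
    simp

/-- The defining relation of `O(d,1)`. -/
def IsLorentz (d : ℕ) (L : Matrix (Fin (d + 1)) (Fin (d + 1)) ℝ) : Prop :=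
  Lᵀ * minkEta d * L = minkEta d

lemma minkEta_mul_self (d : ℕ) : minkEta d * minkEta d = 1 := by
  rw [minkEta, diagonal_mul_diagonal, ← diagonal_one]
  congr 1
  ext i
  split_ifs <;> simp

lemma IsLorentz.mul {d : ℕ} {L M : Matrix (Fin (d + 1)) (Fin (d + 1)) ℝ}
    (hL : IsLorentz d L) (hM : IsLorentz d M) : IsLorentz d (L * M) := by
  unfold IsLorentz at *
  calc (L * M)ᵀ * minkEta d * (L * M) = Mᵀ * (Lᵀ * minkEta d * L) * M := by
        simp only [transpose_mul, Matrix.mul_assoc]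
    _ = minkEta d := by rw [hL, hM]

lemma IsLorentz.isUnit {d : ℕ} {L : Matrix (Fin (d + 1)) (Fin (d + 1)) ℝ}
    (hL : IsLorentz d L) : IsUnit L := by
  have h : (minkEta d * Lᵀ * minkEta d) * L = 1 := by
    rw [Matrix.mul_assoc, Matrix.mul_assoc, ← Matrix.mul_assoc Lᵀ, hL, minkEta_mul_self]
  exact IsUnit.of_mul_eq_one_right _ h

lemma isLorentz_iff {d : ℕ} {L : Matrix (Fin (d + 1)) (Fin (d + 1)) ℝ} :
    IsLorentz d L ↔ ∀ i j, ∑ k : Fin d, L k.castSucc i * L k.castSucc j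
      - L (Fin.last d) i * L (Fin.last d) j = minkEta d i j := by
  rw [IsLorentz, ← Matrix.ext_iff]
  refine forall_congr' fun i => forall_congr' fun j => ?_
  simp [minkEta, Matrix.mul_apply (M := Lᵀ * _), mul_diagonal, Fin.sum_univ_castSucc,
    (Fin.castSucc_lt_last _).ne, sub_eq_add_neg]

section diagO

variable {d : ℕ} (Ω : Matrix (Fin d) (Fin d) ℝ)

@[simp] lemma diagO_castSucc_castSucc (i j : Fin d) :
    diagO d Ω i.castSucc j.castSucc = Ω i j := by
  simp [diagO, (Fin.castSucc_lt_last _).ne]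

@[simp] lemma diagO_castSucc_last (i : Fin d) : diagO d Ω i.castSucc (Fin.last d) = 0 := by
  simp [diagO, (Fin.castSucc_lt_last _).ne]

@[simp] lemma diagO_last_castSucc (i : Fin d) : diagO d Ω (Fin.last d) i.castSucc = 0 := by
  simp [diagO, (Fin.castSucc_lt_last _).ne]

@[simp] lemma diagO_last_last : diagO d Ω (Fin.last d) (Fin.last d) = 1 := by
  simp [diagO]

lemma isLorentz_diagO_iff : IsLorentz d (diagO d Ω) ↔ Ωᵀ * Ω = 1 := by
  simp [isLorentz_iff, Fin.forall_fin_succ', minkEta, diagonal_apply, ← Matrix.ext_iff,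
    Matrix.mul_apply, Matrix.one_apply, (Fin.castSucc_lt_last _).ne, (Fin.castSucc_lt_last _).ne']

end diagO

section boostM

variable {n : ℕ} (a b : ℝ)

@[simp] lemma boostM_castSucc_castSucc (i : Fin n) (j : Fin (n + 2)) :
    boostM (n + 1) a b i.castSucc.castSucc j = if i.castSucc.castSucc = j then 1 else 0 := by
  have := i.isLt
  simp [boostM, Fin.ext_iff, this.ne, (this.trans (Nat.lt_succ_self n)).ne]

@[simp] lemma boostM_castSucc_last (j : Fin (n + 2)) :
    boostM (n + 1) a b (Fin.last n).castSucc j =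
      if j = (Fin.last n).castSucc then a else if j = Fin.last (n + 1) then -b else 0 := by
  simp [boostM, Fin.ext_iff]

@[simp] lemma boostM_last (j : Fin (n + 2)) :
    boostM (n + 1) a b (Fin.last (n + 1)) j =
      if j = (Fin.last n).castSucc then -b else if j = Fin.last (n + 1) then a else 0 := by
  simp [boostM, Fin.ext_iff]

lemma isLorentz_boostM (h : a ^ 2 - b ^ 2 = 1) : IsLorentz (n + 1) (boostM (n + 1) a b) := by
  rw [isLorentz_iff]
  simp only [Fin.sum_univ_castSucc, Fin.forall_fin_succ']
  simp [minkEta, diagonal_apply, (Fin.castSucc_lt_last _).ne, (Fin.castSucc_lt_last _).ne',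
    Fin.castSucc_inj]
  exact ⟨⟨fun i j => by simp only [eq_comm], by linarith, by ring⟩, by ring, by linarith⟩

end boostM

/-- A Lorentz matrix fixing the time axis is block diagonal. -/
lemma IsLorentz.eq_diagO {d : ℕ} {L : Matrix (Fin (d + 1)) (Fin (d + 1)) ℝ}
    (hL : IsLorentz d L) (h0 : ∀ i : Fin d, L i.castSucc (Fin.last d) = 0)
    (h1 : L (Fin.last d) (Fin.last d) = 1) :
    L = diagO d (L.submatrix Fin.castSucc Fin.castSucc) := by
  have h2 (j : Fin d) : L (Fin.last d) j.castSucc = 0 := by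
    have := isLorentz_iff.1 hL j.castSucc (Fin.last d)
    simpa [h0, h1, minkEta, diagonal_apply, (Fin.castSucc_lt_last _).ne] using this
  ext i j
  induction i using Fin.lastCases <;> induction j using Fin.lastCases <;> simp [h0, h1, h2]

/-- Every Lorentz matrix can be brought to block diagonal form by a rotation and a boost. -/
lemma IsLorentz.exists_boostM_mul_diagO_mul {n : ℕ}
    {L : Matrix (Fin (n + 2)) (Fin (n + 2)) ℝ} (hL : IsLorentz (n + 1) L) :
    ∃ (Ω Ω' : Matrix (Fin (n + 1)) (Fin (n + 1)) ℝ) (a b : ℝ), Ωᵀ * Ω = 1 ∧ Ω'ᵀ * Ω' = 1 ∧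
      a ^ 2 - b ^ 2 = 1 ∧ boostM (n + 1) a b * (diagO (n + 1) Ω * L) = diagO (n + 1) Ω' := by
  set v : Fin (n + 1) → ℝ := fun i => L i.castSucc (Fin.last _) with hv
  set c := L (Fin.last _) (Fin.last _) with hc
  set s := √(v ⬝ᵥ v) with hs
  have hs2 : s * s = v ⬝ᵥ v :=
    Real.mul_self_sqrt (Finset.sum_nonneg fun i _ => mul_self_nonneg (v i))
  have hcs : c ^ 2 - s ^ 2 = 1 := by
    have := isLorentz_iff.1 hL (Fin.last _) (Fin.last _)
    simp only [minkEta, diagonal_apply_eq, if_true] at this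
    have h' : v ⬝ᵥ v - c * c = -1 := this
    linarith [hs2, h', sq s, sq c]
  obtain ⟨Ω, hΩ, hΩv⟩ := exists_orthogonal_mulVec_eq v (Pi.single (Fin.last n) s)
    (by simp [hs2])
  have hM (i : Fin (n + 1)) :
      (diagO (n + 1) Ω * L) i.castSucc (Fin.last _) =
        Pi.single (M := fun _ => ℝ) (Fin.last n) s i := by
    rw [← hΩv, Matrix.mul_apply, Fin.sum_univ_castSucc]
    simp [mulVec, dotProduct, hv]
  have hM' : (diagO (n + 1) Ω * L) (Fin.last _) (Fin.last _) = c := by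
    rw [Matrix.mul_apply, Fin.sum_univ_castSucc]
    simp [hc]
  have hN : IsLorentz (n + 1) (boostM (n + 1) c s * (diagO (n + 1) Ω * L)) :=
    (isLorentz_boostM c s hcs).mul (((isLorentz_diagO_iff Ω).2 hΩ).mul hL)
  have key := hN.eq_diagO (by
      intro i
      rw [Matrix.mul_apply, Fin.sum_univ_castSucc]
      simp only [hM, hM']
      induction i using Fin.lastCases <;>
        simp [(Fin.castSucc_lt_last _).ne, (Fin.castSucc_lt_last _).ne', Pi.single_apply]
      ring) (by
      rw [Matrix.mul_apply, Fin.sum_univ_castSucc]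
      simp only [hM, hM']
      simp [(Fin.castSucc_lt_last _).ne, (Fin.castSucc_lt_last _).ne', Pi.single_apply]
      linarith)
  exact ⟨Ω, _, c, s, hΩ, (isLorentz_diagO_iff _).1 (key ▸ hN), hcs, key⟩

/-- every `L ∈ O(d,1)` belongs to the subgroup of invertible
`(d+1) × (d+1)` real matrices generated by `-Id`, the matrices `diag(Ω, 1)` with
`Ω ∈ O(d)`, and the pure boosts `B_{a,b}` with `a² - b² = 1`. -/
theorem stmt13 (d : ℕ) (hd : 2 ≤ d) (L : Matrix (Fin (d + 1)) (Fin (d + 1)) ℝ)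
    (hL : Lᵀ * minkEta d * L = minkEta d) :
    ∃ u : (Matrix (Fin (d + 1)) (Fin (d + 1)) ℝ)ˣ,
      (u : Matrix (Fin (d + 1)) (Fin (d + 1)) ℝ) = L ∧
      u ∈ Subgroup.closure {v : (Matrix (Fin (d + 1)) (Fin (d + 1)) ℝ)ˣ |
        (v : Matrix (Fin (d + 1)) (Fin (d + 1)) ℝ) = -1 ∨
        (∃ Ω : Matrix (Fin d) (Fin d) ℝ, Ωᵀ * Ω = 1 ∧
          (v : Matrix (Fin (d + 1)) (Fin (d + 1)) ℝ) = diagO d Ω) ∨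
        (∃ a b : ℝ, a ^ 2 - b ^ 2 = 1 ∧
          (v : Matrix (Fin (d + 1)) (Fin (d + 1)) ℝ) = boostM d a b)} := by
  obtain ⟨n, rfl⟩ : ∃ n, d = n + 1 := ⟨d - 1, by omega⟩
  obtain ⟨Ω, Ω', a, b, hΩ, hΩ', hab, h⟩ := IsLorentz.exists_boostM_mul_diagO_mul hL
  obtain ⟨B, hB⟩ := (isLorentz_boostM (n := n) a b hab).isUnit
  obtain ⟨R, hR⟩ := ((isLorentz_diagO_iff Ω).2 hΩ).isUnit
  obtain ⟨R', hR'⟩ := ((isLorentz_diagO_iff Ω').2 hΩ').isUnit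
  refine ⟨R⁻¹ * (B⁻¹ * R'), ?_, ?_⟩
  · rw [← hB, ← hR, ← hR'] at h
    rw [Units.val_mul, Units.val_mul, ← h, Units.inv_mul_cancel_left, Units.inv_mul_cancel_left]
  · refine mul_mem (inv_mem (Subgroup.subset_closure ?_))
      (mul_mem (inv_mem (Subgroup.subset_closure ?_)) (Subgroup.subset_closure ?_))
    · exact Or.inr (Or.inl ⟨Ω, hΩ, hR⟩)
    · exact Or.inr (Or.inr ⟨a, b, hab, hB⟩)
    · exact Or.inr (Or.inl ⟨Ω', hΩ', hR'⟩)
end
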